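/- Local Lipschitz bound on the gradient of the empirical L₂ risk (Lemma 3): let σ : ℝ → ℝ be bounded and differentiable with a Lipschitz continuous and bounded derivative. Let α_n ≥ 1, t_n ≥ L_n > 0, γ_n* ≥ 1, B_n ≥ 1, r ≥ 2d, and let w₁, w₂, v be weight vectors with max{|(w₁)^{(L)}_{1,1,k}|, |(w₂)^{(L)}_{1,1,k}|} ≤ γ_n* for k = 1,…,K_n, max{|(w₁)^{(l)}_{k,i,j}|, |(w₂)^{(l)}_{k,i,j}|} ≤ B_n for l = 1,…,L−1, and ‖w₂ − v‖² ≤ 8·(t_n/L_n)·max{F_n(v), 1}. Then for X_1,…,X_n ∈ [−α_n, α_n]^d there is a constant c₈ (depending only on d, L, r and σ) with ‖(∇_w F_n)(w₁) − (∇_w F_n)(w₂)‖ ≤ c₈·max{√(F_n(v)), 1}·(γ_n*)²·B_n^{3L}·α_n³·K_n^{3/2}·√(t_n/L_n)·‖w₁ − w₂‖. -/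

import Mathlib

open scoped BigOperators

/-- Index type for the weights of a linear combination of `K` fully connected networks
with `L` layers, `r` neurons per layer and input dimension `d`:
`out k` is the output weight `w^{(L)}_{1,1,k}` (paper index `k+1`),
`inner l k i j` is the weight `w^{(l+1)}_{k+1,i+1,j}` (layers `1,…,L-1`, `j = 0` the bias),
`input k i j` is the weight `w^{(0)}_{k+1,i+1,j}` (`j = 0` the bias). -/
inductive NNIdx (K L r d : ℕ) : Type where
  | out (k : Fin K)
  | inner (l : Fin (L - 1)) (k : Fin K) (i : Fin r) (j : Fin (r + 1))
  | input (k : Fin K) (i : Fin r) (j : Fin (d + 1))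
  deriving DecidableEq, Fintype

/-- `nOut σ K L r d w k l i x` is the output `f^{(l)}_{k+1,i+1}(x)` of neuron `i+1`
in layer `l` of the `k+1`-st fully connected network with weights `w` and activation `σ`. -/
noncomputable def nOut (σ : ℝ → ℝ) (K L r d : ℕ) (w : NNIdx K L r d → ℝ) (k : Fin K) :
    ℕ → Fin r → (Fin d → ℝ) → ℝ
  | 0, _, _ => 0
  | 1, i, x => σ ((∑ j : Fin d, w (NNIdx.input k i j.succ) * x j) + w (NNIdx.input k i 0))
  | l + 2, i, x =>
    if h : l < L - 1 then
      σ ((∑ j : Fin r, w (NNIdx.inner ⟨l, h⟩ k i j.succ) * nOut σ K L r d w k (l + 1) j x)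
        + w (NNIdx.inner ⟨l, h⟩ k i 0))
    else 0

/-- The network `f_w(x) = ∑_{k=1}^{K} w^{(L)}_{1,1,k}·f^{(L)}_{k,1}(x)`. -/
noncomputable def fnet (σ : ℝ → ℝ) (K L r d : ℕ) (w : NNIdx K L r d → ℝ) (x : Fin d → ℝ) : ℝ :=
  if h : 0 < r then ∑ k : Fin K, w (NNIdx.out k) * nOut σ K L r d w k L ⟨0, h⟩ x else 0

/-- The empirical L₂ risk `F_n(w) = (1/n)·∑_{i=1}^n |f_w(X_i) - Y_i|²`. -/
noncomputable def empRisk (σ : ℝ → ℝ) (K L r d n : ℕ)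
    (X : Fin n → Fin d → ℝ) (Y : Fin n → ℝ)
    (w : EuclideanSpace ℝ (NNIdx K L r d)) : ℝ :=
  (n : ℝ)⁻¹ * ∑ i : Fin n, (fnet σ K L r d w (X i) - Y i) ^ 2



section NNHelpers

/-- derivative of `nOut` with respect to the weights -/
noncomputable def dOut (σ : ℝ → ℝ) (K L r d : ℕ) (w : NNIdx K L r d → ℝ) (k : Fin K) :
    ℕ → Fin r → (Fin d → ℝ) → (EuclideanSpace ℝ (NNIdx K L r d) →L[ℝ] ℝ)
  | 0, _, _ => 0
  | 1, i, x => deriv σ ((∑ j : Fin d, w (NNIdx.input k i j.succ) * x j) + w (NNIdx.input k i 0)) •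
      ((∑ j : Fin d, x j • (EuclideanSpace.proj (NNIdx.input k i j.succ) :
        EuclideanSpace ℝ (NNIdx K L r d) →L[ℝ] ℝ)) + EuclideanSpace.proj (NNIdx.input k i 0))
  | l + 2, i, x =>
    if h : l < L - 1 then
      deriv σ ((∑ j : Fin r, w (NNIdx.inner ⟨l, h⟩ k i j.succ) * nOut σ K L r d w k (l + 1) j x)
        + w (NNIdx.inner ⟨l, h⟩ k i 0)) •
      ((∑ j : Fin r, (w (NNIdx.inner ⟨l, h⟩ k i j.succ) • dOut σ K L r d w k (l + 1) j x +
        nOut σ K L r d w k (l + 1) j x • (EuclideanSpace.proj (NNIdx.inner ⟨l, h⟩ k i j.succ) :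
          EuclideanSpace ℝ (NNIdx K L r d) →L[ℝ] ℝ)))
        + EuclideanSpace.proj (NNIdx.inner ⟨l, h⟩ k i 0))
    else 0

theorem hasFDerivAt_coord {ι : Type*} [Fintype ι] (p : ι) (w : EuclideanSpace ℝ ι) :
    HasFDerivAt (fun w : EuclideanSpace ℝ ι => w p)
      (EuclideanSpace.proj p : EuclideanSpace ℝ ι →L[ℝ] ℝ) w :=
  (EuclideanSpace.proj p : EuclideanSpace ℝ ι →L[ℝ] ℝ).hasFDerivAt

theorem norm_proj_le {ι : Type*} [Fintype ι] (p : ι) :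
    ‖(EuclideanSpace.proj p : EuclideanSpace ℝ ι →L[ℝ] ℝ)‖ ≤ 1 := by
  refine ContinuousLinearMap.opNorm_le_bound _ zero_le_one fun x => ?_
  simpa using PiLp.norm_apply_le x p

theorem nOut_hasFDerivAt (σ : ℝ → ℝ) (hσ : Differentiable ℝ σ) (K L r d : ℕ)
    (w : EuclideanSpace ℝ (NNIdx K L r d)) (k : Fin K) (l : ℕ) (x : Fin d → ℝ) :
    ∀ i : Fin r, HasFDerivAt
      (fun w : EuclideanSpace ℝ (NNIdx K L r d) => nOut σ K L r d w k l i x)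
      (dOut σ K L r d w k l i x) w := by
  induction l with
  | zero => intro i; simpa [nOut, dOut] using hasFDerivAt_const (0:ℝ) w
  | succ l ih =>
    intro i
    cases l with
    | zero =>
      simp only [nOut, dOut]
      refine HasDerivAt.comp_hasFDerivAt w (hσ _).hasDerivAt ?_
      refine HasFDerivAt.add (HasFDerivAt.fun_sum fun j _ => ?_) (hasFDerivAt_coord _ w)
      exact (hasFDerivAt_coord _ w).mul_const (x j)
    | succ l =>
      simp only [nOut, dOut]
      split_ifs with h
      · refine HasDerivAt.comp_hasFDerivAt w (hσ _).hasDerivAt ?_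
        refine HasFDerivAt.add (HasFDerivAt.fun_sum fun j _ => ?_) (hasFDerivAt_coord _ w)
        exact (hasFDerivAt_coord _ w).mul (ih j)
      · exact hasFDerivAt_const (0:ℝ) w

theorem nOut_abs_le (σ : ℝ → ℝ) (M : ℝ) (hM : 1 ≤ M) (hσ : ∀ x, |σ x| ≤ M) (K L r d : ℕ)
    (w : NNIdx K L r d → ℝ) (k : Fin K) (l : ℕ) (x : Fin d → ℝ) (i : Fin r) :
    |nOut σ K L r d w k l i x| ≤ M := by
  rcases l with _ | _ | l
  · simp [nOut]; linarith
  · simp only [nOut]; exact hσ _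
  · simp only [nOut]; split_ifs
    · exact hσ _
    · simp; linarith

theorem norm_fin_sum_le {E : Type*} [SeminormedAddCommGroup E] (m : ℕ) (f : Fin m → E) (c : ℝ)
    (h : ∀ i, ‖f i‖ ≤ c) : ‖∑ i, f i‖ ≤ m * c := by
  simpa using norm_sum_le_of_le Finset.univ (fun i _ => h i)

/-- difference of inner preactivations -/
theorem pre_diff (r : ℕ) (a b f g : Fin r → ℝ) (a0 b0 B M N T : ℝ) (hB : 0 ≤ B) (hN : 0 ≤ N)
    (ha : ∀ j, |a j| ≤ B) (hg : ∀ j, |g j| ≤ M) (hab : ∀ j, |a j - b j| ≤ N)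
    (hab0 : |a0 - b0| ≤ N) (hfg : ∀ j, |f j - g j| ≤ T) :
    |((∑ j, a j * f j) + a0) - ((∑ j, b j * g j) + b0)| ≤ r * (B * T + N * M) + N := by
  have : ((∑ j, a j * f j) + a0) - ((∑ j, b j * g j) + b0)
      = (∑ j, (a j * (f j - g j) + (a j - b j) * g j)) + (a0 - b0) := by
    rw [add_sub_add_comm, ← Finset.sum_sub_distrib]
    congr 1; exact Finset.sum_congr rfl fun j _ => by ring
  rw [this]
  refine (abs_add_le _ _).trans (add_le_add ?_ hab0)
  refine norm_fin_sum_le (E := ℝ) r _ _ fun j => ?_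
  refine (norm_add_le _ _).trans ?_
  rw [norm_mul, norm_mul]
  exact add_le_add (mul_le_mul (ha j) (hfg j) (norm_nonneg _) hB)
    (mul_le_mul (hab j) (hg j) (norm_nonneg _) hN)

theorem pre_diff_in (d : ℕ) (a b x : Fin d → ℝ) (a0 b0 α N : ℝ) (hN : 0 ≤ N)
    (hx : ∀ j, |x j| ≤ α) (hab : ∀ j, |a j - b j| ≤ N) (hab0 : |a0 - b0| ≤ N) :
    |((∑ j, a j * x j) + a0) - ((∑ j, b j * x j) + b0)| ≤ d * (N * α) + N := by
  have : ((∑ j, a j * x j) + a0) - ((∑ j, b j * x j) + b0)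
      = (∑ j, ((a j - b j) * x j)) + (a0 - b0) := by
    rw [add_sub_add_comm, ← Finset.sum_sub_distrib]
    congr 1; exact Finset.sum_congr rfl fun j _ => by ring
  rw [this]
  refine (abs_add_le _ _).trans (add_le_add ?_ hab0)
  refine norm_fin_sum_le (E := ℝ) d _ _ fun j => ?_
  rw [norm_mul]
  exact mul_le_mul (hab j) (hx j) (norm_nonneg _) hN

theorem one_le_P {B α : ℝ} (l : ℕ) (hB : 1 ≤ B) (hα : 1 ≤ α) : 1 ≤ B ^ l * α :=
  one_le_mul_of_one_le_of_one_le (one_le_pow₀ hB) hα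

theorem nOut_lip (σ : ℝ → ℝ) (M : ℝ) (hM : 1 ≤ M) (hσ : ∀ x, |σ x| ≤ M)
    (hσ' : ∀ x y, |σ x - σ y| ≤ M * |x - y|) (L r d l : ℕ) :
    ∃ c : ℝ, 0 ≤ c ∧ ∀ (K : ℕ) (w v : NNIdx K L r d → ℝ) (k : Fin K) (x : Fin d → ℝ)
      (B α N : ℝ), 1 ≤ B → 1 ≤ α → 0 ≤ N → (∀ j, |x j| ≤ α) →
      (∀ l i j, |w (NNIdx.inner l k i j)| ≤ B) →
      (∀ l i j, |w (NNIdx.inner l k i j) - v (NNIdx.inner l k i j)| ≤ N) →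
      (∀ i j, |w (NNIdx.input k i j) - v (NNIdx.input k i j)| ≤ N) →
      ∀ i, |nOut σ K L r d w k l i x - nOut σ K L r d v k l i x| ≤ c * (B ^ l * α) * N := by
  induction l with
  | zero =>
    refine ⟨0, le_rfl, ?_⟩
    intros; simp [nOut]
  | succ l ih =>
    cases l with
    | zero =>
      refine ⟨M * (d + 1), by positivity, ?_⟩
      intro K w v k x B α N hB hα hN hx hw hin hinp i
      simp only [nOut]
      refine (hσ' _ _).trans ?_
      have h1 := pre_diff_in d (fun j => w (NNIdx.input k i j.succ))
        (fun j => v (NNIdx.input k i j.succ)) x _ _ α N hN hx (fun j => hinp i _) (hinp i 0)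
      have h2 : N ≤ N * α := le_mul_of_one_le_right hN hα
      have h3 : N * α ≤ B * (N * α) := le_mul_of_one_le_left (by positivity) hB
      have h4 : (d:ℝ) * (N * α) + N ≤ (d + 1) * (B * (N * α)) := by
        have : (d:ℝ) * (N * α) ≤ d * (B * (N * α)) := by gcongr
        linarith
      calc M * _ ≤ M * ((d + 1) * (B * (N * α))) := by gcongr; exact h1.trans h4
        _ = _ := by ring
    | succ l =>
      obtain ⟨c, hc, ih⟩ := ih
      refine ⟨M * (r * (c + M) + 1), by positivity, ?_⟩
      intro K w v k x B α N hB hα hN hx hw hin hinp i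
      simp only [nOut]
      have hP := one_le_P (l + 2) hB hα
      split_ifs with h
      · refine (hσ' _ _).trans ?_
        have h1 := pre_diff r (fun j => w (NNIdx.inner ⟨l, h⟩ k i j.succ))
          (fun j => v (NNIdx.inner ⟨l, h⟩ k i j.succ))
          (fun j => nOut σ K L r d w k (l + 1) j x) (fun j => nOut σ K L r d v k (l + 1) j x)
          _ _ B M N _ (by linarith) hN (fun j => hw _ i _)
          (fun j => nOut_abs_le σ M hM hσ K L r d v k (l+1) x j) (fun j => hin _ i _)
          (hin ⟨l, h⟩ i 0) (fun j => ih K w v k x B α N hB hα hN hx hw hin hinp j)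
        have h2 : N ≤ (B ^ (l + 2) * α) * N := le_mul_of_one_le_left hN hP
        calc M * _ ≤ M * (r * (B * (c * (B ^ (l + 1) * α) * N) + N * M) + N) := by gcongr
          _ ≤ M * (r * (B * (c * (B ^ (l + 1) * α) * N) + ((B ^ (l + 2) * α) * N) * M)
              + (B ^ (l + 2) * α) * N) := by gcongr
          _ = _ := by ring
      · simp; positivity

/-- norm of the derivative of an inner preactivation -/
theorem dpre_norm {E : Type*} [SeminormedAddCommGroup E] [NormedSpace ℝ E] (r : ℕ)
    (a f : Fin r → ℝ) (D p : Fin r → E) (p0 : E) (B M T : ℝ) (hB : 0 ≤ B) (hM : 0 ≤ M)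
    (ha : ∀ j, |a j| ≤ B) (hf : ∀ j, |f j| ≤ M) (hD : ∀ j, ‖D j‖ ≤ T) (hp : ∀ j, ‖p j‖ ≤ 1)
    (hp0 : ‖p0‖ ≤ 1) :
    ‖(∑ j, (a j • D j + f j • p j)) + p0‖ ≤ r * (B * T + M * 1) + 1 := by
  refine (norm_add_le _ _).trans (add_le_add ?_ hp0)
  refine norm_fin_sum_le r _ _ fun j => ?_
  refine (norm_add_le _ _).trans ?_
  rw [norm_smul, norm_smul]
  exact add_le_add (mul_le_mul (ha j) (hD j) (norm_nonneg _) hB)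
    (mul_le_mul (hf j) (hp j) (norm_nonneg _) hM)

theorem dpre_norm_in {E : Type*} [SeminormedAddCommGroup E] [NormedSpace ℝ E] (d : ℕ)
    (x : Fin d → ℝ) (p : Fin d → E) (p0 : E) (α : ℝ) (hα : 0 ≤ α)
    (hx : ∀ j, |x j| ≤ α) (hp : ∀ j, ‖p j‖ ≤ 1) (hp0 : ‖p0‖ ≤ 1) :
    ‖(∑ j, x j • p j) + p0‖ ≤ d * (α * 1) + 1 := by
  refine (norm_add_le _ _).trans (add_le_add ?_ hp0)
  refine norm_fin_sum_le d _ _ fun j => ?_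
  rw [norm_smul]
  exact mul_le_mul (hx j) (hp j) (norm_nonneg _) hα

theorem dOut_norm (σ : ℝ → ℝ) (M : ℝ) (hM : 1 ≤ M) (hσ : ∀ x, |σ x| ≤ M)
    (hσ' : ∀ x, |deriv σ x| ≤ M) (L r d l : ℕ) :
    ∃ c : ℝ, 0 ≤ c ∧ ∀ (K : ℕ) (w : NNIdx K L r d → ℝ) (k : Fin K) (x : Fin d → ℝ)
      (B α : ℝ), 1 ≤ B → 1 ≤ α → (∀ j, |x j| ≤ α) →
      (∀ l i j, |w (NNIdx.inner l k i j)| ≤ B) →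
      ∀ i, ‖dOut σ K L r d w k l i x‖ ≤ c * (B ^ l * α) := by
  induction l with
  | zero =>
    refine ⟨0, le_rfl, ?_⟩
    intros; simp [dOut]
  | succ l ih =>
    cases l with
    | zero =>
      refine ⟨M * (d + 1), by positivity, ?_⟩
      intro K w k x B α hB hα hx hw i
      simp only [dOut]
      rw [norm_smul]
      have h1 := dpre_norm_in d x (fun j => (EuclideanSpace.proj (NNIdx.input k i j.succ) :
        EuclideanSpace ℝ (NNIdx K L r d) →L[ℝ] ℝ)) (EuclideanSpace.proj (NNIdx.input k i 0))
        α (by linarith) hx (fun j => norm_proj_le _) (norm_proj_le _)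
      have h3 : α ≤ B * α := le_mul_of_one_le_left (by positivity) hB
      have h4 : (d:ℝ) * (α * 1) + 1 ≤ (d + 1) * (B * α) := by
        have : (d:ℝ) * (α * 1) ≤ d * (B * α) := by rw [mul_one]; gcongr
        linarith
      calc _ ≤ M * ((d + 1) * (B * α)) :=
            mul_le_mul (hσ' _) (h1.trans h4) (norm_nonneg _) (by linarith)
        _ = _ := by ring
    | succ l =>
      obtain ⟨c, hc, ih⟩ := ih
      refine ⟨M * (r * (c + M) + 1), by positivity, ?_⟩
      intro K w k x B α hB hα hx hw i
      simp only [dOut]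
      have hP := one_le_P (l + 2) hB hα
      split_ifs with h
      · rw [norm_smul]
        have h1 := dpre_norm r (fun j => w (NNIdx.inner ⟨l, h⟩ k i j.succ))
          (fun j => nOut σ K L r d w k (l + 1) j x) (fun j => dOut σ K L r d w k (l + 1) j x)
          (fun j => (EuclideanSpace.proj (NNIdx.inner ⟨l, h⟩ k i j.succ) :
            EuclideanSpace ℝ (NNIdx K L r d) →L[ℝ] ℝ))
          (EuclideanSpace.proj (NNIdx.inner ⟨l, h⟩ k i 0))
          B M _ (by linarith) (by linarith) (fun j => hw _ i _)
          (fun j => nOut_abs_le σ M hM hσ K L r d w k (l+1) x j)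
          (fun j => ih K w k x B α hB hα hx hw j) (fun j => norm_proj_le _) (norm_proj_le _)
        calc _ ≤ M * (r * (B * (c * (B ^ (l + 1) * α)) + M * 1) + 1) :=
              mul_le_mul (hσ' _) h1 (norm_nonneg _) (by linarith)
          _ ≤ M * (r * (B * (c * (B ^ (l + 1) * α)) + M * (B ^ (l + 2) * α))
              + (B ^ (l + 2) * α)) := by gcongr
          _ = _ := by ring
      · simp; positivity

/-- difference of derivatives of inner preactivations -/
theorem dpre_diff {E : Type*} [SeminormedAddCommGroup E] [NormedSpace ℝ E] (r : ℕ)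
    (a b f g : Fin r → ℝ) (D G p : Fin r → E) (p0 : E) (B N S T U : ℝ) (hB : 0 ≤ B)
    (hN : 0 ≤ N) (hS : 0 ≤ S)
    (ha : ∀ j, |a j| ≤ B) (hab : ∀ j, |a j - b j| ≤ N) (hfg : ∀ j, |f j - g j| ≤ S)
    (hG : ∀ j, ‖G j‖ ≤ T) (hDG : ∀ j, ‖D j - G j‖ ≤ U) (hp : ∀ j, ‖p j‖ ≤ 1) :
    ‖((∑ j, (a j • D j + f j • p j)) + p0) - ((∑ j, (b j • G j + g j • p j)) + p0)‖
      ≤ r * (B * U + N * T + S * 1) := by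
  rw [add_sub_add_right_eq_sub, ← Finset.sum_sub_distrib]
  refine norm_fin_sum_le r _ _ fun j => ?_
  have : a j • D j + f j • p j - (b j • G j + g j • p j)
    = a j • (D j - G j) + (a j - b j) • G j + (f j - g j) • p j := by module
  rw [this]
  refine (norm_add₃_le).trans ?_
  rw [norm_smul, norm_smul, norm_smul]
  exact add_le_add (add_le_add (mul_le_mul (ha j) (hDG j) (norm_nonneg _) hB)
    (mul_le_mul (hab j) (hG j) (norm_nonneg _) hN))
    (mul_le_mul (hfg j) (hp j) (norm_nonneg _) hS)

theorem smul_diff {E : Type*} [SeminormedAddCommGroup E] [NormedSpace ℝ E]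
    (s t : ℝ) (A A' : E) (S T M U : ℝ) (hS : 0 ≤ S) (hM : 0 ≤ M) (h1 : |s - t| ≤ S)
    (h2 : ‖A‖ ≤ T) (h3 : |t| ≤ M) (h4 : ‖A - A'‖ ≤ U) :
    ‖s • A - t • A'‖ ≤ S * T + M * U := by
  have : s • A - t • A' = (s - t) • A + t • (A - A') := by module
  rw [this]
  refine (norm_add_le _ _).trans ?_
  rw [norm_smul, norm_smul]
  exact add_le_add (mul_le_mul h1 h2 (norm_nonneg _) hS) (mul_le_mul h3 h4 (norm_nonneg _) hM)

theorem dOut_lip (σ : ℝ → ℝ) (M : ℝ) (hM : 1 ≤ M) (hσ : ∀ x, |σ x| ≤ M)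
    (hσl : ∀ x y, |σ x - σ y| ≤ M * |x - y|)
    (hσ' : ∀ x, |deriv σ x| ≤ M) (hσ'l : ∀ x y, |deriv σ x - deriv σ y| ≤ M * |x - y|)
    (L r d l : ℕ) :
    ∃ c : ℝ, 0 ≤ c ∧ ∀ (K : ℕ) (w v : NNIdx K L r d → ℝ) (k : Fin K) (x : Fin d → ℝ)
      (B α N : ℝ), 1 ≤ B → 1 ≤ α → 0 ≤ N → (∀ j, |x j| ≤ α) →
      (∀ l i j, |w (NNIdx.inner l k i j)| ≤ B) →
      (∀ l i j, |v (NNIdx.inner l k i j)| ≤ B) →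
      (∀ l i j, |w (NNIdx.inner l k i j) - v (NNIdx.inner l k i j)| ≤ N) →
      (∀ i j, |w (NNIdx.input k i j) - v (NNIdx.input k i j)| ≤ N) →
      ∀ i, ‖dOut σ K L r d w k l i x - dOut σ K L r d v k l i x‖ ≤ c * (B ^ l * α) ^ 2 * N := by
  induction l with
  | zero =>
    refine ⟨0, le_rfl, ?_⟩
    intros; simp [dOut]
  | succ l ih =>
    cases l with
    | zero =>
      refine ⟨M * (d + 1) * (d + 1), by positivity, ?_⟩
      intro K w v k x B α N hB hα hN hx hw hv hin hinp i
      simp only [dOut]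
      have h1 := dpre_norm_in d x (fun j => (EuclideanSpace.proj (NNIdx.input k i j.succ) :
        EuclideanSpace ℝ (NNIdx K L r d) →L[ℝ] ℝ)) (EuclideanSpace.proj (NNIdx.input k i 0))
        α (by linarith) hx (fun j => norm_proj_le _) (norm_proj_le _)
      have h5 := pre_diff_in d (fun j => w (NNIdx.input k i j.succ))
        (fun j => v (NNIdx.input k i j.succ)) x _ _ α N hN hx (fun j => hinp i _) (hinp i 0)
      have h3 : α ≤ B * α := le_mul_of_one_le_left (by positivity) hB
      have h4 : (d:ℝ) * (α * 1) + 1 ≤ (d + 1) * (B * α) := by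
        have : (d:ℝ) * (α * 1) ≤ d * (B * α) := by rw [mul_one]; gcongr
        linarith
      have h6 : (d:ℝ) * (N * α) + N ≤ (d + 1) * (B * α) * N := by
        calc _ = ((d:ℝ) * (α * 1) + 1) * N := by ring
          _ ≤ _ := by gcongr
      refine (smul_diff _ _ _ _ (M * ((d + 1) * (B * α) * N)) _ M 0 (by positivity)
        (by positivity) ((hσ'l _ _).trans ?_) (h1.trans h4) (hσ' _) ?_).trans (le_of_eq ?_)
      · gcongr; exact h5.trans h6
      · simp
      · ring
    | succ l =>
      obtain ⟨c, hc, ih⟩ := ih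
      obtain ⟨c1, hc1, H1⟩ := nOut_lip σ M hM hσ hσl L r d (l + 1)
      obtain ⟨c2, hc2, H2⟩ := dOut_norm σ M hM hσ hσ' L r d (l + 1)
      refine ⟨M * (r * (c1 + M) + 1) * (r * (c2 + M) + 1) + M * (r * (c + c2 + c1)),
        by positivity, ?_⟩
      intro K w v k x B α N hB hα hN hx hw hv hin hinp i
      simp only [dOut]
      have hP := one_le_P (l + 2) hB hα
      split_ifs with h
      · have h0 := pre_diff r (fun j => w (NNIdx.inner ⟨l, h⟩ k i j.succ))
          (fun j => v (NNIdx.inner ⟨l, h⟩ k i j.succ))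
          (fun j => nOut σ K L r d w k (l + 1) j x) (fun j => nOut σ K L r d v k (l + 1) j x)
          _ _ B M N _ (by linarith) hN (fun j => hw _ i _)
          (fun j => nOut_abs_le σ M hM hσ K L r d v k (l+1) x j) (fun j => hin _ i _)
          (hin ⟨l, h⟩ i 0) (fun j => H1 K w v k x B α N hB hα hN hx hw hin hinp j)
        have h1 := dpre_norm r (fun j => w (NNIdx.inner ⟨l, h⟩ k i j.succ))
          (fun j => nOut σ K L r d w k (l + 1) j x) (fun j => dOut σ K L r d w k (l + 1) j x)
          (fun j => (EuclideanSpace.proj (NNIdx.inner ⟨l, h⟩ k i j.succ) :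
            EuclideanSpace ℝ (NNIdx K L r d) →L[ℝ] ℝ))
          (EuclideanSpace.proj (NNIdx.inner ⟨l, h⟩ k i 0))
          B M _ (by linarith) (by linarith) (fun j => hw _ i _)
          (fun j => nOut_abs_le σ M hM hσ K L r d w k (l+1) x j)
          (fun j => H2 K w k x B α hB hα hx hw j) (fun j => norm_proj_le _) (norm_proj_le _)
        have h2 := dpre_diff r (fun j => w (NNIdx.inner ⟨l, h⟩ k i j.succ))
          (fun j => v (NNIdx.inner ⟨l, h⟩ k i j.succ))
          (fun j => nOut σ K L r d w k (l + 1) j x) (fun j => nOut σ K L r d v k (l + 1) j x)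
          (fun j => dOut σ K L r d w k (l + 1) j x) (fun j => dOut σ K L r d v k (l + 1) j x)
          (fun j => (EuclideanSpace.proj (NNIdx.inner ⟨l, h⟩ k i j.succ) :
            EuclideanSpace ℝ (NNIdx K L r d) →L[ℝ] ℝ))
          (EuclideanSpace.proj (NNIdx.inner ⟨l, h⟩ k i 0))
          B N _ _ _ (by linarith) hN (by positivity) (fun j => hw _ i _) (fun j => hin _ i _)
          (fun j => H1 K w v k x B α N hB hα hN hx hw hin hinp j)
          (fun j => H2 K v k x B α hB hα hx hv j)
          (fun j => ih K w v k x B α N hB hα hN hx hw hv hin hinp j) (fun j => norm_proj_le _)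
        set P := B ^ (l + 1) * α with hPdef
        have hP1 : 1 ≤ P := one_le_P (l + 1) hB hα
        have hQ : B ^ (l + 2) * α = B * P := by rw [hPdef]; ring
        simp only [show l + 1 + 1 = l + 2 from rfl]
        rw [hQ] at hP ⊢
        have e0 : (r:ℝ) * (B * (c1 * P * N) + N * M) + N ≤ (r * (c1 + M) + 1) * (B * P) * N := by
          calc _ ≤ (r:ℝ) * (B * (c1 * P * N) + ((B * P) * N) * M) + (B * P) * N := by
                have : N ≤ (B * P) * N := le_mul_of_one_le_left hN hP
                gcongr
            _ = _ := by ring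
        have e1 : (r:ℝ) * (B * (c2 * P) + M * 1) + 1 ≤ (r * (c2 + M) + 1) * (B * P) := by
          calc _ ≤ (r:ℝ) * (B * (c2 * P) + M * (B * P)) + (B * P) := by gcongr
            _ = _ := by ring
        have hPP : P ≤ (B * P) ^ 2 := by
          have : P ≤ B * P := le_mul_of_one_le_left (by linarith) hB
          nlinarith
        have hBB : B * P ^ 2 ≤ (B * P) ^ 2 := by
          have : B ≤ B ^ 2 := by nlinarith
          rw [mul_pow B P 2]; exact mul_le_mul_of_nonneg_right this (sq_nonneg P)
        have e2 : (r:ℝ) * (B * (c * P ^ 2 * N) + N * (c2 * P) + c1 * P * N * 1)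
            ≤ r * (c + c2 + c1) * (B * P) ^ 2 * N := by
          calc _ = (r:ℝ) * (c * (B * P ^ 2) * N + N * (c2 * P) + c1 * P * N * 1) := by ring
            _ ≤ (r:ℝ) * (c * (B * P) ^ 2 * N + N * (c2 * (B * P) ^ 2)
                + c1 * (B * P) ^ 2 * N * 1) := by gcongr
            _ = _ := by ring
        refine (smul_diff _ _ _ _ (M * ((r * (c1 + M) + 1) * (B * P) * N)) _ M _ (by positivity)
          (by positivity) ((hσ'l _ _).trans ?_) (h1.trans e1) (hσ' _)
          (h2.trans e2)).trans (le_of_eq ?_)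
        · gcongr; exact h0.trans e0
        · ring
      · simp; positivity

/-- block of a weight -/
def nnBlk {K L r d : ℕ} : NNIdx K L r d → Fin K
  | NNIdx.out k => k
  | NNIdx.inner _ k _ _ => k
  | NNIdx.input k _ _ => k

/-- norm of a block -/
noncomputable def blkN {K L r d : ℕ} (u : EuclideanSpace ℝ (NNIdx K L r d)) (k : Fin K) : ℝ :=
  Real.sqrt (∑ p with nnBlk p = k, u p ^ 2)

theorem abs_le_blkN {K L r d : ℕ} (u : EuclideanSpace ℝ (NNIdx K L r d)) (p : NNIdx K L r d)
    (k : Fin K) (h : nnBlk p = k) : |u p| ≤ blkN u k := by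
  refine Real.abs_le_sqrt ?_
  exact Finset.single_le_sum (f := fun p => u p ^ 2) (fun _ _ => sq_nonneg _) (by simp [h])

theorem sum_blkN_le {K L r d : ℕ} (u : EuclideanSpace ℝ (NNIdx K L r d)) :
    ∑ k, blkN u k ≤ Real.sqrt K * ‖u‖ := by
  have h : ∑ k, blkN u k ^ 2 = ‖u‖ ^ 2 := by
    rw [EuclideanSpace.real_norm_sq_eq]
    simp only [blkN]
    rw [← Finset.sum_fiberwise Finset.univ nnBlk (fun p => u p ^ 2)]
    exact Finset.sum_congr rfl fun k _ =>
      Real.sq_sqrt (Finset.sum_nonneg fun _ _ => sq_nonneg _)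
  refine abs_le_of_sq_le_sq' ?_ (by positivity) |>.2
  have := sq_sum_le_card_mul_sum_sq (s := (Finset.univ : Finset (Fin K))) (f := blkN u)
  rw [h] at this
  simpa [mul_pow] using this

theorem fnet_lip (σ : ℝ → ℝ) (M : ℝ) (hM : 1 ≤ M) (hσ : ∀ x, |σ x| ≤ M)
    (hσ' : ∀ x y, |σ x - σ y| ≤ M * |x - y|) (L r d : ℕ) :
    ∃ c : ℝ, 0 ≤ c ∧ ∀ (K : ℕ) (w v : EuclideanSpace ℝ (NNIdx K L r d)) (x : Fin d → ℝ)
      (B α γ : ℝ), 1 ≤ B → 1 ≤ α → 1 ≤ γ → (∀ j, |x j| ≤ α) →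
      (∀ k, |w (NNIdx.out k)| ≤ γ) →
      (∀ l k i j, |w (NNIdx.inner l k i j)| ≤ B) →
      |fnet σ K L r d w x - fnet σ K L r d v x|
        ≤ c * γ * (B ^ L * α) * Real.sqrt K * ‖w - v‖ := by
  obtain ⟨c, hc, H⟩ := nOut_lip σ M hM hσ hσ' L r d L
  refine ⟨c + M, by positivity, ?_⟩
  intro K w v x B α γ hB hα hγ hx hout hw
  have hP := one_le_P L hB hα
  set P := B ^ L * α
  simp only [fnet]
  split_ifs with h
  · rw [← Finset.sum_sub_distrib]
    have key : ∀ k : Fin K, |w (NNIdx.out k) * nOut σ K L r d w k L ⟨0, h⟩ x -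
        v (NNIdx.out k) * nOut σ K L r d v k L ⟨0, h⟩ x| ≤ (c + M) * γ * P * blkN (w - v) k := by
      intro k
      have hN : 0 ≤ blkN (w - v) k := Real.sqrt_nonneg _
      have h1 := H K w v k x B α (blkN (w - v) k) hB hα hN hx (fun l i j => hw l k i j)
        (fun l i j => abs_le_blkN (w - v) _ k rfl) (fun i j => abs_le_blkN (w - v) _ k rfl) ⟨0, h⟩
      have h2 : |w (NNIdx.out k) - v (NNIdx.out k)| ≤ blkN (w - v) k :=
        abs_le_blkN (w - v) (NNIdx.out k) k rfl
      have h3 := nOut_abs_le σ M hM hσ K L r d v k L x ⟨0, h⟩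
      have e : w (NNIdx.out k) * nOut σ K L r d w k L ⟨0, h⟩ x -
        v (NNIdx.out k) * nOut σ K L r d v k L ⟨0, h⟩ x
        = w (NNIdx.out k) * (nOut σ K L r d w k L ⟨0, h⟩ x - nOut σ K L r d v k L ⟨0, h⟩ x)
         + (w (NNIdx.out k) - v (NNIdx.out k)) * nOut σ K L r d v k L ⟨0, h⟩ x := by ring
      rw [e]
      refine (abs_add_le _ _).trans ?_
      rw [abs_mul, abs_mul]
      calc _ ≤ γ * (c * P * blkN (w - v) k) + blkN (w - v) k * M :=
            add_le_add (mul_le_mul (hout k) h1 (abs_nonneg _) (by linarith))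
              (mul_le_mul h2 h3 (abs_nonneg _) hN)
        _ ≤ γ * (c * P * blkN (w - v) k) + (γ * P) * (blkN (w - v) k * M) := by
            have : 1 ≤ γ * P := one_le_mul_of_one_le_of_one_le hγ hP
            have := le_mul_of_one_le_left (show 0 ≤ blkN (w - v) k * M by positivity) this
            linarith
        _ = _ := by ring
    calc _ ≤ ∑ k, |w (NNIdx.out k) * nOut σ K L r d w k L ⟨0, h⟩ x -
        v (NNIdx.out k) * nOut σ K L r d v k L ⟨0, h⟩ x| := Finset.abs_sum_le_sum_abs _ _
      _ ≤ ∑ k, (c + M) * γ * P * blkN (w - v) k := Finset.sum_le_sum fun k _ => key k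
      _ = (c + M) * γ * P * ∑ k, blkN (w - v) k := by rw [Finset.mul_sum]
      _ ≤ (c + M) * γ * P * (Real.sqrt K * ‖w - v‖) := by gcongr; exact sum_blkN_le _
      _ = _ := by ring
  · simp; positivity

/-- derivative of `fnet` -/
noncomputable def dnet (σ : ℝ → ℝ) (K L r d : ℕ) (w : NNIdx K L r d → ℝ) (x : Fin d → ℝ) :
    EuclideanSpace ℝ (NNIdx K L r d) →L[ℝ] ℝ :=
  if h : 0 < r then ∑ k : Fin K, (w (NNIdx.out k) • dOut σ K L r d w k L ⟨0, h⟩ x +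
    nOut σ K L r d w k L ⟨0, h⟩ x • (EuclideanSpace.proj (NNIdx.out k) :
      EuclideanSpace ℝ (NNIdx K L r d) →L[ℝ] ℝ)) else 0

theorem fnet_hasFDerivAt (σ : ℝ → ℝ) (hσ : Differentiable ℝ σ) (K L r d : ℕ)
    (w : EuclideanSpace ℝ (NNIdx K L r d)) (x : Fin d → ℝ) :
    HasFDerivAt (fun w : EuclideanSpace ℝ (NNIdx K L r d) => fnet σ K L r d w x)
      (dnet σ K L r d w x) w := by
  simp only [fnet, dnet]
  split_ifs with h
  · exact HasFDerivAt.fun_sum fun k _ =>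
      (hasFDerivAt_coord _ w).mul (nOut_hasFDerivAt σ hσ K L r d w k L x _)
  · exact hasFDerivAt_const (0:ℝ) w

theorem dnet_bounds (σ : ℝ → ℝ) (M : ℝ) (hM : 1 ≤ M) (hσ : ∀ x, |σ x| ≤ M)
    (hσl : ∀ x y, |σ x - σ y| ≤ M * |x - y|)
    (hσ' : ∀ x, |deriv σ x| ≤ M) (hσ'l : ∀ x y, |deriv σ x - deriv σ y| ≤ M * |x - y|)
    (L r d : ℕ) :
    ∃ c : ℝ, 0 ≤ c ∧ ∀ (K : ℕ) (w v : EuclideanSpace ℝ (NNIdx K L r d)) (x : Fin d → ℝ)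
      (B α γ : ℝ), 1 ≤ B → 1 ≤ α → 1 ≤ γ → (∀ j, |x j| ≤ α) →
      (∀ k, |w (NNIdx.out k)| ≤ γ) →
      (∀ l k i j, |w (NNIdx.inner l k i j)| ≤ B) →
      (∀ l k i j, |v (NNIdx.inner l k i j)| ≤ B) →
      ‖dnet σ K L r d w x‖ ≤ K * (c * γ * (B ^ L * α)) ∧
      ‖dnet σ K L r d w x - dnet σ K L r d v x‖
        ≤ K * (c * γ * (B ^ L * α) ^ 2 * ‖w - v‖) := by
  obtain ⟨c1, hc1, H1⟩ := nOut_lip σ M hM hσ hσl L r d L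
  obtain ⟨c2, hc2, H2⟩ := dOut_norm σ M hM hσ hσ' L r d L
  obtain ⟨c3, hc3, H3⟩ := dOut_lip σ M hM hσ hσl hσ' hσ'l L r d L
  refine ⟨c1 + c2 + c3 + M, by positivity, ?_⟩
  intro K w v x B α γ hB hα hγ hx hout hw hv
  have hP := one_le_P L hB hα
  have hcoord : ∀ p, |w p - v p| ≤ ‖w - v‖ := fun p => PiLp.norm_apply_le (w - v) p
  have hN := norm_nonneg (w - v)
  have h1 : ∀ k i, _ := fun k => H1 K w v k x B α ‖w - v‖ hB hα hN hx (fun l i j => hw l k i j)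
    (fun _ _ _ => hcoord _) (fun _ _ => hcoord _)
  have h2 : ∀ k i, _ := fun k => H2 K w k x B α hB hα hx (fun l i j => hw l k i j)
  have h2' : ∀ k i, _ := fun k => H2 K v k x B α hB hα hx (fun l i j => hv l k i j)
  have h3 : ∀ k i, _ := fun k => H3 K w v k x B α ‖w - v‖ hB hα hN hx (fun l i j => hw l k i j)
    (fun l i j => hv l k i j) (fun _ _ _ => hcoord _) (fun _ _ => hcoord _)
  set P := B ^ L * α
  have hPP : P ≤ P ^ 2 := by nlinarith
  have hγP : P ≤ γ * P := le_mul_of_one_le_left (by linarith) hγ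
  have hγP2 : P ≤ γ * P ^ 2 := hPP.trans (le_mul_of_one_le_left (by positivity) hγ)
  simp only [dnet]
  split_ifs with h
  · constructor
    · refine norm_fin_sum_le K _ _ fun k => ?_
      refine (norm_add_le _ _).trans ?_
      rw [norm_smul, norm_smul]
      calc _ ≤ γ * (c2 * P) + M * 1 :=
            add_le_add (mul_le_mul (hout k) (h2 k _) (norm_nonneg _) (by linarith))
              (mul_le_mul (nOut_abs_le σ M hM hσ K L r d w k L x _) (norm_proj_le _)
                (norm_nonneg _) (by linarith))
        _ ≤ γ * (c2 * P) + M * (γ * P) + (c1 + c3) * γ * P := by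
            have : M * 1 ≤ M * (γ * P) := by gcongr; linarith
            have : 0 ≤ (c1 + c3) * γ * P := by positivity
            linarith
        _ = _ := by ring
    · have := dpre_diff K (fun k => w (NNIdx.out k)) (fun k => v (NNIdx.out k))
        (fun k => nOut σ K L r d w k L ⟨0, h⟩ x) (fun k => nOut σ K L r d v k L ⟨0, h⟩ x)
        (fun k => dOut σ K L r d w k L ⟨0, h⟩ x) (fun k => dOut σ K L r d v k L ⟨0, h⟩ x)
        (fun k => (EuclideanSpace.proj (NNIdx.out k) :
            EuclideanSpace ℝ (NNIdx K L r d) →L[ℝ] ℝ)) 0 γ ‖w - v‖ _ _ _ (by linarith) hN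
        (by positivity) hout (fun k => hcoord _) (fun k => h1 k _) (fun k => h2' k _)
        (fun k => h3 k _) (fun k => norm_proj_le _)
      simp only [add_zero] at this
      refine this.trans ?_
      gcongr
      calc γ * (c3 * P ^ 2 * ‖w - v‖) + ‖w - v‖ * (c2 * P) + c1 * P * ‖w - v‖ * 1
          ≤ γ * (c3 * P ^ 2 * ‖w - v‖) + ‖w - v‖ * (c2 * (γ * P ^ 2))
            + c1 * (γ * P ^ 2) * ‖w - v‖ * 1 + M * γ * P ^ 2 * ‖w - v‖ := by
            have : 0 ≤ M * γ * P ^ 2 * ‖w - v‖ := by positivity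
            refine le_add_of_le_of_nonneg ?_ this
            gcongr
        _ = _ := by ring
  · constructor <;> simp <;> positivity

theorem empRisk_hasFDerivAt (σ : ℝ → ℝ) (hσ : Differentiable ℝ σ) (K L r d n : ℕ)
    (X : Fin n → Fin d → ℝ) (Y : Fin n → ℝ) (w : EuclideanSpace ℝ (NNIdx K L r d)) :
    HasFDerivAt (empRisk σ K L r d n X Y)
      ((n:ℝ)⁻¹ • ∑ i, (2 * (fnet σ K L r d w (X i) - Y i)) • dnet σ K L r d w (X i)) w := by
  unfold empRisk
  refine HasFDerivAt.const_mul (HasFDerivAt.fun_sum fun i _ => ?_) _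
  have := ((fnet_hasFDerivAt σ hσ K L r d w (X i)).sub_const (Y i)).pow 2
  simpa using this

theorem norm_gradient_sub {E : Type*} [NormedAddCommGroup E] [InnerProductSpace ℝ E]
    [CompleteSpace E] (f : E → ℝ) (a b : E) (f1 f2 : E →L[ℝ] ℝ) (h1 : HasFDerivAt f f1 a)
    (h2 : HasFDerivAt f f2 b) : ‖gradient f a - gradient f b‖ = ‖f1 - f2‖ := by
  rw [gradient, gradient, h1.fderiv, h2.fderiv, ← map_sub, LinearIsometryEquiv.norm_map]

theorem avg_le (n : ℕ) (f : Fin n → ℝ) (c : ℝ) (hc : 0 ≤ c) (h : ∀ i, f i ≤ c) :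
    (n:ℝ)⁻¹ * ∑ i, f i ≤ c := by
  rcases Nat.eq_zero_or_pos n with rfl | hn
  · simpa using hc
  · have : ∑ i, f i ≤ n * c := by
      simpa using Finset.sum_le_sum (s := Finset.univ) fun i _ => h i
    have hn' : (0:ℝ) < n := by exact_mod_cast hn
    rw [inv_mul_le_iff₀ hn']; exact this

theorem avg_abs_le (n : ℕ) (f : Fin n → ℝ) :
    (n:ℝ)⁻¹ * ∑ i, |f i| ≤ Real.sqrt ((n:ℝ)⁻¹ * ∑ i, f i ^ 2) := by
  rcases Nat.eq_zero_or_pos n with rfl | hn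
  · simp
  · have hn' : (0:ℝ) < n := by exact_mod_cast hn
    refine Real.le_sqrt_of_sq_le ?_
    have := sq_sum_le_card_mul_sum_sq (s := (Finset.univ : Finset (Fin n))) (f := fun i => |f i|)
    simp only [sq_abs, Finset.card_univ, Fintype.card_fin] at this
    rw [mul_pow]
    calc _ ≤ (n:ℝ)⁻¹ ^ 2 * (n * ∑ i, f i ^ 2) := by gcongr
      _ = _ := by field_simp

end NNHelpers

/-- Lemma 3: local Lipschitz bound on the gradient of the empirical L₂ risk.
The constant `c₈` depends only on `d`, `L`, `r` and `σ`. -/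
theorem gradient_of_empirical_risk_lipschitz
    (d L r : ℕ) (σ : ℝ → ℝ)
    (hσbdd : ∃ M : ℝ, ∀ x, |σ x| ≤ M)
    (hσdiff : Differentiable ℝ σ)
    (hσ'bdd : ∃ M : ℝ, ∀ x, |deriv σ x| ≤ M)
    (hσ'lip : ∃ M : ℝ, ∀ x y : ℝ, |deriv σ x - deriv σ y| ≤ M * |x - y|)
    (hrd : 2 * d ≤ r) :
    ∃ c8 : ℝ, 0 < c8 ∧
      ∀ (K n : ℕ) (X : Fin n → Fin d → ℝ) (Y : Fin n → ℝ)
        (w1 w2 v : EuclideanSpace ℝ (NNIdx K L r d))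
        (αn Ln γn Bn : ℝ) (tn : ℕ),
        1 ≤ αn → 0 < Ln → Ln ≤ (tn : ℝ) → 1 ≤ γn → 1 ≤ Bn →
        (∀ k : Fin K, max |w1 (NNIdx.out k)| |w2 (NNIdx.out k)| ≤ γn) →
        (∀ (l : Fin (L - 1)) (k : Fin K) (i : Fin r) (j : Fin (r + 1)),
          max |w1 (NNIdx.inner l k i j)| |w2 (NNIdx.inner l k i j)| ≤ Bn) →
        ‖w2 - v‖ ^ 2 ≤ 8 * ((tn : ℝ) / Ln) * max (empRisk σ K L r d n X Y v) 1 →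
        (∀ (i : Fin n) (j : Fin d), |X i j| ≤ αn) →
        ‖gradient (empRisk σ K L r d n X Y) w1 - gradient (empRisk σ K L r d n X Y) w2‖
          ≤ c8 * max (Real.sqrt (empRisk σ K L r d n X Y v)) 1 * γn ^ 2 * Bn ^ (3 * L)
            * αn ^ 3 * (K : ℝ) ^ ((3 : ℝ) / 2) * Real.sqrt ((tn : ℝ) / Ln) * ‖w1 - w2‖ := by
  obtain ⟨M1, hM1⟩ := hσbdd
  obtain ⟨M2, hM2⟩ := hσ'bdd
  obtain ⟨M3, hM3⟩ := hσ'lip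
  obtain ⟨M, hM, hσ, hσ', hσ'l⟩ : ∃ M : ℝ, 1 ≤ M ∧ (∀ x, |σ x| ≤ M) ∧ (∀ x, |deriv σ x| ≤ M) ∧
      (∀ x y, |deriv σ x - deriv σ y| ≤ M * |x - y|) := by
    refine ⟨max (max 1 M1) (max M2 M3), ?_, fun x => (hM1 x).trans ?_, fun x => (hM2 x).trans ?_,
      fun x y => (hM3 x y).trans ?_⟩
    · simp
    · simp
    · simp
    · gcongr; simp
  have hσl : ∀ x y, |σ x - σ y| ≤ M * |x - y| := fun x y =>
    Convex.norm_image_sub_le_of_norm_deriv_le (s := Set.univ) (fun z _ => hσdiff z)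
      (fun z _ => hσ' z) convex_univ (Set.mem_univ y) (Set.mem_univ x)
  obtain ⟨c1, hc1, H1⟩ := fnet_lip σ M hM hσ hσl L r d
  obtain ⟨c2, hc2, H2⟩ := dnet_bounds σ M hM hσ hσl hσ' hσ'l L r d
  refine ⟨2 * c1 * c2 + 2 * (1 + 3 * c1) * c2 + 1, by positivity, ?_⟩
  intro K n X Y w1 w2 v α Ln γ B tn hα hLn hLt hγ hB hout hin hv hX
  rw [norm_gradient_sub _ _ _ _ _ (empRisk_hasFDerivAt σ hσdiff K L r d n X Y w1)
    (empRisk_hasFDerivAt σ hσdiff K L r d n X Y w2)]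
  rcases Nat.eq_zero_or_pos K with hK | hK
  · have : w1 = w2 := by
      ext p
      subst hK
      exact (nnBlk p).elim0
    subst this
    simp
  have hout1 : ∀ k, |w1 (NNIdx.out k)| ≤ γ := fun k => (le_max_left _ _).trans (hout k)
  have hout2 : ∀ k, |w2 (NNIdx.out k)| ≤ γ := fun k => (le_max_right _ _).trans (hout k)
  have hin1 : ∀ l k i j, |w1 (NNIdx.inner l k i j)| ≤ B :=
    fun l k i j => (le_max_left _ _).trans (hin l k i j)
  have hin2 : ∀ l k i j, |w2 (NNIdx.inner l k i j)| ≤ B :=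
    fun l k i j => (le_max_right _ _).trans (hin l k i j)
  have A1 : ∀ i, _ := fun i => H1 K w1 w2 (X i) B α γ hB hα hγ (hX i) hout1 hin1
  have A2 : ∀ i, _ := fun i => H1 K w2 v (X i) B α γ hB hα hγ (hX i) hout2 hin2
  have A3 : ∀ i, _ := fun i => H2 K w1 w2 (X i) B α γ hB hα hγ (hX i) hout1 hin1 hin2
  have hP := one_le_P L hB hα
  have hP3 : B ^ (3 * L) * α ^ 3 = (B ^ L * α) ^ 3 := by rw [mul_pow, ← pow_mul, mul_comm L 3]
  set P := B ^ L * α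
  have hs : 1 ≤ Real.sqrt K := Real.one_le_sqrt.2 (by exact_mod_cast hK)
  have hK32 : (K:ℝ) ^ ((3:ℝ) / 2) = K * Real.sqrt K := by
    have hK0 : (0:ℝ) < K := by exact_mod_cast hK
    rw [Real.sqrt_eq_rpow, show (3:ℝ) / 2 = 1 + 1 / 2 by norm_num, Real.rpow_add hK0,
      Real.rpow_one]
  set s := Real.sqrt K
  have hq2 : 1 ≤ (tn:ℝ) / Ln := (one_le_div hLn).2 hLt
  have hq : 1 ≤ Real.sqrt ((tn:ℝ) / Ln) := Real.one_le_sqrt.2 hq2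
  have hqq : Real.sqrt ((tn:ℝ) / Ln) ^ 2 = (tn:ℝ) / Ln := Real.sq_sqrt (by linarith)
  set q := Real.sqrt ((tn:ℝ) / Ln)
  have hF0 : 0 ≤ empRisk σ K L r d n X Y v := by unfold empRisk; positivity
  have hFs : Real.sqrt (empRisk σ K L r d n X Y v) ≤
    max (Real.sqrt (empRisk σ K L r d n X Y v)) 1 := le_max_left _ _
  have hm1 : 1 ≤ max (Real.sqrt (empRisk σ K L r d n X Y v)) 1 := le_max_right _ _
  have hFm : max (empRisk σ K L r d n X Y v) 1 ≤
      max (Real.sqrt (empRisk σ K L r d n X Y v)) 1 ^ 2 := by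
    refine max_le ?_ (one_le_pow₀ hm1)
    conv_lhs => rw [← Real.sq_sqrt hF0]
    gcongr
  set m := max (Real.sqrt (empRisk σ K L r d n X Y v)) 1
  have hwv : ‖w2 - v‖ ≤ 3 * q * m := by
    refine (abs_le_of_sq_le_sq' ?_ (by positivity)).2
    calc _ ≤ _ := hv
      _ ≤ 8 * ((tn:ℝ) / Ln) * m ^ 2 := by gcongr
      _ = 8 * (q ^ 2 * m ^ 2) := by rw [hqq]; ring
      _ ≤ 9 * (q ^ 2 * m ^ 2) := by gcongr; norm_num
      _ = _ := by ring
  have havg : (n:ℝ)⁻¹ * ∑ i, |fnet σ K L r d w2 (X i) - Y i|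
      ≤ (1 + 3 * c1) * (γ * P * s * q * m) := by
    have e1 : ∀ i, |fnet σ K L r d w2 (X i) - Y i| - |fnet σ K L r d v (X i) - Y i|
        ≤ c1 * γ * P * s * (3 * q * m) := fun i => by
      refine (abs_sub_abs_le_abs_sub _ _).trans ?_
      rw [sub_sub_sub_cancel_right]
      refine (A2 i).trans ?_
      gcongr
    have e2 := avg_le n _ _ (by positivity) e1
    rw [Finset.sum_sub_distrib, mul_sub] at e2
    have e3 := avg_abs_le n (fun i => fnet σ K L r d v (X i) - Y i)
    have e4 : (n:ℝ)⁻¹ * ∑ i, |fnet σ K L r d v (X i) - Y i| ≤ m := e3.trans hFs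
    have e5 : m ≤ γ * P * s * q * m := by
      refine le_mul_of_one_le_left (by positivity) ?_
      refine one_le_mul_of_one_le_of_one_le (one_le_mul_of_one_le_of_one_le
        (one_le_mul_of_one_le_of_one_le hγ hP) hs) hq
    calc _ ≤ c1 * γ * P * s * (3 * q * m) + γ * P * s * q * m := by linarith
      _ = _ := by ring
  have hΔ := norm_nonneg (w1 - w2)
  set Δ := ‖w1 - w2‖
  have hterm : ∀ i, ‖(2 * (fnet σ K L r d w1 (X i) - Y i)) • dnet σ K L r d w1 (X i)
      - (2 * (fnet σ K L r d w2 (X i) - Y i)) • dnet σ K L r d w2 (X i)‖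
      ≤ 2 * (c1 * γ * P * s * Δ) * (K * (c2 * γ * P))
        + 2 * |fnet σ K L r d w2 (X i) - Y i| * (K * (c2 * γ * P ^ 2 * Δ)) := fun i => by
    refine smul_diff _ _ _ _ _ _ _ _ (by positivity) (by positivity) ?_ (A3 i).1 ?_ (A3 i).2
    · rw [← mul_sub, sub_sub_sub_cancel_right, abs_mul, abs_two]
      gcongr; exact A1 i
    · rw [abs_mul, abs_two]
  have hsplit : ∀ f g : Fin n → (EuclideanSpace ℝ (NNIdx K L r d) →L[ℝ] ℝ),
      ‖(n:ℝ)⁻¹ • ∑ i, f i - (n:ℝ)⁻¹ • ∑ i, g i‖ = (n:ℝ)⁻¹ * ‖∑ i, (f i - g i)‖ := by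
    intro f g
    have e : (n:ℝ)⁻¹ • ∑ i, f i - (n:ℝ)⁻¹ • ∑ i, g i = (n:ℝ)⁻¹ • ∑ i, (f i - g i) := by
      rw [Finset.sum_sub_distrib]; module
    rw [e, norm_smul, norm_inv, Real.norm_natCast]
  refine (hsplit _ _).trans_le ?_
  have hsum : (n:ℝ)⁻¹ * ‖∑ i, ((2 * (fnet σ K L r d w1 (X i) - Y i)) • dnet σ K L r d w1 (X i)
      - (2 * (fnet σ K L r d w2 (X i) - Y i)) • dnet σ K L r d w2 (X i))‖
      ≤ 2 * (c1 * γ * P * s * Δ) * (K * (c2 * γ * P)) +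
        2 * ((1 + 3 * c1) * (γ * P * s * q * m)) * (K * (c2 * γ * P ^ 2 * Δ)) := by
    calc _ ≤ (n:ℝ)⁻¹ * ∑ i, (2 * (c1 * γ * P * s * Δ) * (K * (c2 * γ * P))
        + 2 * |fnet σ K L r d w2 (X i) - Y i| * (K * (c2 * γ * P ^ 2 * Δ))) := by
          gcongr
          exact norm_sum_le_of_le _ fun i _ => hterm i
      _ = (n:ℝ)⁻¹ * ∑ _i : Fin n, (2 * (c1 * γ * P * s * Δ) * (K * (c2 * γ * P)))
        + 2 * ((n:ℝ)⁻¹ * ∑ i, |fnet σ K L r d w2 (X i) - Y i|)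
          * (K * (c2 * γ * P ^ 2 * Δ)) := by
          have e : ∀ (f : Fin n → ℝ) (C : ℝ), ∑ i, 2 * f i * C = 2 * (∑ i, f i) * C := by
            intro f C; rw [← Finset.sum_mul, ← Finset.mul_sum]
          rw [Finset.sum_add_distrib, e (fun i => |fnet σ K L r d w2 (X i) - Y i|), mul_add]; ring
      _ ≤ _ := by
          refine add_le_add (avg_le n (fun _ => 2 * (c1 * γ * P * s * Δ) * (K * (c2 * γ * P)))
            (2 * (c1 * γ * P * s * Δ) * (K * (c2 * γ * P))) (by positivity) fun _ => le_rfl) ?_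
          gcongr
  refine hsum.trans ?_
  have hP23 : P ^ 2 ≤ P ^ 3 * q * m := by
    calc P ^ 2 ≤ P ^ 3 := pow_le_pow_right₀ hP (by norm_num)
      _ ≤ P ^ 3 * (q * m) :=
        le_mul_of_one_le_right (by positivity) (one_le_mul_of_one_le_of_one_le hq hm1)
      _ = _ := by ring
  calc _ = 2 * c1 * c2 * (γ ^ 2 * s * K * Δ) * P ^ 2
        + 2 * (1 + 3 * c1) * c2 * (m * γ ^ 2 * P ^ 3 * (K * s) * q * Δ) := by ring
    _ ≤ 2 * c1 * c2 * (γ ^ 2 * s * K * Δ) * (P ^ 3 * q * m)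
        + 2 * (1 + 3 * c1) * c2 * (m * γ ^ 2 * P ^ 3 * (K * s) * q * Δ)
        + m * γ ^ 2 * P ^ 3 * (K * s) * q * Δ := by
        refine le_add_of_le_of_nonneg ?_ (by positivity)
        gcongr
    _ = (2 * c1 * c2 + 2 * (1 + 3 * c1) * c2 + 1) * m * γ ^ 2 * P ^ 3 * (K * s) * q * Δ := by
        ring
    _ = _ := by rw [hK32, ← hP3]; ring
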